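/- Let \Psi be defined by the recurrence \Psi(a,b,0)=2, \Psi(a,b,1)=1, \Psi(a,b,n+1)=(2a-b)^{\delta(n)}\Psi(a,b,n) - a\Psi(a,b,n-1) over \mathbb{Z}[x,\alpha]. Let D_n(x,\alpha) = \sum_{i=0}^{\lfloor n/2 \rfloor} (n/(n-i)) \binom{n-i}{i} (-\alpha)^i x^{n-2i} be the Dickson polynomial of the first kind (n \ge 1). Then D_n(x,\alpha) = x^{\delta(n)} \Psi(\alpha, 2\alpha - x^2, n). -/

import Mathlib

open Finset Polynomial

/-- parity indicator: 1 if odd, 0 if even -/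
def pdelta (n : ℕ) : ℕ := n % 2

/-- Ψ(a,b,0)=2, Ψ(a,b,1)=1, Ψ(a,b,n+1)=(2a-b)^{δ(n)}Ψ(a,b,n) - aΨ(a,b,n-1) -/
def Psi {R : Type*} [CommRing R] (a b : R) : ℕ → R
  | 0 => 2
  | 1 => 1
  | (n+2) => (2*a-b)^(pdelta (n+1)) * Psi a b (n+1) - a * Psi a b n

/-- Φ(a,b,0)=0, Φ(a,b,1)=1, Φ(a,b,n+1)=(2a-b)^{δ(n+1)}Φ(a,b,n) - aΦ(a,b,n-1) -/
def Phi {R : Type*} [CommRing R] (a b : R) : ℕ → R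
  | 0 => 0
  | 1 => 1
  | (n+2) => (2*a-b)^(pdelta (n+2)) * Phi a b (n+1) - a * Phi a b n

/-- The coefficient `n / (n - i) * (n - i).choose i` of the `n`-th Dickson polynomial. -/
def dicksonCoeff (n i : ℕ) : ℕ := n * (n - i).choose i / (n - i)

theorem dicksonCoeff_eq_zero {n i : ℕ} (h : n < 2 * i) : dicksonCoeff n i = 0 := by
  rw [dicksonCoeff, Nat.choose_eq_zero_of_lt (by omega), mul_zero, Nat.zero_div]

theorem dicksonCoeff_zero_right {n : ℕ} (hn : 1 ≤ n) : dicksonCoeff n 0 = 1 := by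
  simp [dicksonCoeff, Nat.div_self hn]

theorem dicksonCoeff_add_add_two (m i : ℕ) :
    dicksonCoeff (m + i + 2) (i + 1) = (m + 1).choose (i + 1) + m.choose i := by
  have hsub : m + i + 2 - (i + 1) = m + 1 := by omega
  rw [dicksonCoeff, hsub]
  refine Nat.div_eq_of_eq_mul_right m.succ_pos ?_
  linear_combination -Nat.add_one_mul_choose_eq m i

theorem dicksonCoeff_add_two {n : ℕ} (hn : 1 ≤ n) (i : ℕ) :
    dicksonCoeff (n + 2) (i + 1) = dicksonCoeff (n + 1) (i + 1) + dicksonCoeff n i := by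
  rcases lt_or_ge n (2 * i) with h | h
  · simp [dicksonCoeff_eq_zero, h, show n + 2 < 2 * (i + 1) by omega,
      show n + 1 < 2 * (i + 1) by omega]
  obtain ⟨m, rfl⟩ : ∃ m, n = m + i + 1 := ⟨n - i - 1, by omega⟩
  have h₁ := dicksonCoeff_add_add_two (m + 1) i
  have h₂ := dicksonCoeff_add_add_two m i
  rw [show m + i + 1 + 2 = m + 1 + i + 2 by ring, h₁, h₂]
  cases i with
  | zero => simp [dicksonCoeff_zero_right]
  | succ j =>
    rw [show m + (j + 1) + 1 = m + j + 2 by ring, dicksonCoeff_add_add_two,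
      Nat.choose_succ_succ' (m + 1) (j + 1), Nat.choose_succ_succ' m j]
    ring

section DicksonSum

variable {R : Type*} [CommRing R]

/-- The value at `x` of the `n`-th Dickson polynomial of the first kind with parameter `α`,
for `n ≠ 0`, as an explicit sum. -/
def dicksonSum (x α : R) (n : ℕ) : R :=
  ∑ i ∈ range (n / 2 + 1), (dicksonCoeff n i : R) * (-α) ^ i * x ^ (n - 2 * i)

theorem dicksonSum_eq_sum_range (x α : R) {n N : ℕ} (h : n / 2 + 1 ≤ N) :
    dicksonSum x α n =
      ∑ i ∈ range N, (dicksonCoeff n i : R) * (-α) ^ i * x ^ (n - 2 * i) := by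
  refine sum_subset (range_mono h) fun i _ hi => ?_
  rw [mem_range] at hi
  simp [dicksonCoeff_eq_zero (show n < 2 * i by omega)]

theorem dicksonSum_add_two (x α : R) {n : ℕ} (hn : 1 ≤ n) :
    dicksonSum x α (n + 2) = x * dicksonSum x α (n + 1) - α * dicksonSum x α n := by
  rw [dicksonSum_eq_sum_range x α (show (n + 2) / 2 + 1 ≤ n / 2 + 1 + 1 by omega),
    dicksonSum_eq_sum_range x α (show (n + 1) / 2 + 1 ≤ n / 2 + 1 + 1 by omega),
    dicksonSum, sum_range_succ' _ (n / 2 + 1), sum_range_succ' _ (n / 2 + 1), mul_add,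
    mul_sum, mul_sum,
    add_sub_right_comm, ← sum_sub_distrib]
  congr 1
  · refine sum_congr rfl fun i _ => ?_
    rw [dicksonCoeff_add_two hn, show n + 2 - 2 * (i + 1) = n - 2 * i by omega]
    rcases lt_or_ge n (2 * i + 1) with h | h
    · rw [dicksonCoeff_eq_zero (show n + 1 < 2 * (i + 1) by omega)]
      push_cast
      ring
    · rw [show n - 2 * i = n + 1 - 2 * (i + 1) + 1 by omega]
      push_cast
      ring
  · rw [dicksonCoeff_zero_right (by omega), dicksonCoeff_zero_right (by omega)]
    simp
    ring

theorem pow_pdelta_mul_Psi_add_two (x α : R) (n : ℕ) :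
    x ^ pdelta (n + 2) * Psi α (2 * α - x ^ 2) (n + 2) =
      x * (x ^ pdelta (n + 1) * Psi α (2 * α - x ^ 2) (n + 1)) -
        α * (x ^ pdelta n * Psi α (2 * α - x ^ 2) n) := by
  rw [Psi]
  rcases Nat.mod_two_eq_zero_or_one n with h | h
  · simp only [pdelta, h, show (n + 1) % 2 = 1 by omega, show (n + 2) % 2 = 0 by omega]
    ring
  · simp only [pdelta, h, show (n + 1) % 2 = 0 by omega, show (n + 2) % 2 = 1 by omega]
    ring

theorem dicksonSum_add_one (x α : R) (n : ℕ) :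
    dicksonSum x α (n + 1) = x ^ pdelta (n + 1) * Psi α (2 * α - x ^ 2) (n + 1) := by
  induction n using Nat.twoStepInduction with
  | zero => simp [dicksonSum, dicksonCoeff, pdelta, Psi]
  | one =>
    simp [dicksonSum, dicksonCoeff, pdelta, Psi, sum_range_succ]
    ring
  | more n ih₁ ih₂ =>
    rw [dicksonSum_add_two x α n.succ_pos, ih₁, ih₂, pow_pdelta_mul_Psi_add_two x α (n + 1)]

end DicksonSum

theorem stmt14 {R : Type*} [CommRing R] (x α : R) (n : ℕ) (hn : 1 ≤ n) :
    ∑ i ∈ Finset.range (n / 2 + 1),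
        ((n * (n - i).choose i / (n - i) : ℕ) : R) * (-α) ^ i * x ^ (n - 2 * i) =
      x ^ pdelta n * Psi α (2 * α - x ^ 2) n := by
  obtain ⟨m, rfl⟩ := Nat.exists_eq_add_of_le' hn
  exact dicksonSum_add_one x α m
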